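/- The 𝕜-algebras E_n(q) and E′_n(q) are isomorphic. More precisely, there is a 𝕜-algebra isomorphism G : E_n(q) → E′_n(q) with G(g_a) = g_a for all 1 ≤ a ≤ n−1 and G(e_a) = Σ_{B ∈ SetPar_n, A_a ⊆ B} ē(B), where A_a ∈ SetPar_n is the set partition whose only non-singleton block is {a, a+1} and A ⊆ B means that every block of B is a union of blocks of A. -/

import Mathlib

open scoped Classical

noncomputable section

namespace BT

/-- Generators of the bt-algebra (0-based indexing): `g a h` is the paper's `g_{a+1}`,
`e a h` is the paper's `e_{a+1}`. -/
inductive Gen (n : ℕ) : Type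
  | g : (a : ℕ) → a + 1 < n → Gen n
  | e : (a : ℕ) → a + 1 < n → Gen n

variable (𝕜 : Type) [Field 𝕜] (n : ℕ) (q : 𝕜)

abbrev F : Type := FreeAlgebra 𝕜 (Gen n)

def G (a : ℕ) (h : a + 1 < n) : F 𝕜 n := FreeAlgebra.ι 𝕜 (Gen.g a h)

def Eg (a : ℕ) (h : a + 1 < n) : F 𝕜 n := FreeAlgebra.ι 𝕜 (Gen.e a h)

/-- The defining relations of the bt-algebra `E_n(q)`. -/
inductive Rel : F 𝕜 n → F 𝕜 n → Prop
  | ge (a : ℕ) (h : a + 1 < n) :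
      Rel (G 𝕜 n a h * Eg 𝕜 n a h) (Eg 𝕜 n a h * G 𝕜 n a h)
  | braid (a : ℕ) (h : a + 2 < n) :
      Rel (G 𝕜 n a (by omega) * G 𝕜 n (a + 1) h * G 𝕜 n a (by omega))
        (G 𝕜 n (a + 1) h * G 𝕜 n a (by omega) * G 𝕜 n (a + 1) h)
  | gfar (a b : ℕ) (ha : a + 1 < n) (hb : b + 1 < n) (hab : a + 1 < b) :
      Rel (G 𝕜 n a ha * G 𝕜 n b hb) (G 𝕜 n b hb * G 𝕜 n a ha)
  | egg (a b : ℕ) (ha : a + 1 < n) (hb : b + 1 < n) (hab : b = a + 1 ∨ a = b + 1) :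
      Rel (Eg 𝕜 n a ha * G 𝕜 n b hb * G 𝕜 n a ha)
        (G 𝕜 n b hb * G 𝕜 n a ha * Eg 𝕜 n b hb)
  | eeg1 (a b : ℕ) (ha : a + 1 < n) (hb : b + 1 < n) (hab : b = a + 1 ∨ a = b + 1) :
      Rel (Eg 𝕜 n a ha * Eg 𝕜 n b hb * G 𝕜 n b hb)
        (Eg 𝕜 n a ha * G 𝕜 n b hb * Eg 𝕜 n a ha)
  | eeg2 (a b : ℕ) (ha : a + 1 < n) (hb : b + 1 < n) (hab : b = a + 1 ∨ a = b + 1) :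
      Rel (Eg 𝕜 n a ha * G 𝕜 n b hb * Eg 𝕜 n a ha)
        (G 𝕜 n b hb * Eg 𝕜 n a ha * Eg 𝕜 n b hb)
  | ee (a b : ℕ) (ha : a + 1 < n) (hb : b + 1 < n) :
      Rel (Eg 𝕜 n a ha * Eg 𝕜 n b hb) (Eg 𝕜 n b hb * Eg 𝕜 n a ha)
  | gefar (a b : ℕ) (ha : a + 1 < n) (hb : b + 1 < n) (hab : a + 1 < b ∨ b + 1 < a) :
      Rel (G 𝕜 n a ha * Eg 𝕜 n b hb) (Eg 𝕜 n b hb * G 𝕜 n a ha)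
  | esq (a : ℕ) (ha : a + 1 < n) :
      Rel (Eg 𝕜 n a ha * Eg 𝕜 n a ha) (Eg 𝕜 n a ha)
  | gsq (a : ℕ) (ha : a + 1 < n) :
      Rel (G 𝕜 n a ha ^ 2)
        (algebraMap 𝕜 (F 𝕜 n) q + (q - 1) • (Eg 𝕜 n a ha * G 𝕜 n a ha))

/-- The bt-algebra `E_n(q)`. -/
abbrev B : Type := RingQuot (Rel 𝕜 n q)

def π : F 𝕜 n →ₐ[𝕜] B 𝕜 n q := RingQuot.mkAlgHom 𝕜 (Rel 𝕜 n q)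

def g (a : ℕ) (h : a + 1 < n) : B 𝕜 n q := π 𝕜 n q (G 𝕜 n a h)

def e (a : ℕ) (h : a + 1 < n) : B 𝕜 n q := π 𝕜 n q (Eg 𝕜 n a h)

/-- The simple transposition `σ_a = (a, a+1)` (0-based). -/
def sw (a : ℕ) (h : a + 1 < n) : Equiv.Perm (Fin n) :=
  Equiv.swap ⟨a, by omega⟩ ⟨a + 1, h⟩

/-- `g_a` if the index is in range, else `1`. -/
def gTot (a : ℕ) : B 𝕜 n q := if h : a + 1 < n then g 𝕜 n q a h else 1

/-- `e_a` if the index is in range, else `1`. -/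
def eTot (a : ℕ) : B 𝕜 n q := if h : a + 1 < n then e 𝕜 n q a h else 1

/-- `g_a⁻¹ = q⁻¹ g_a + (q⁻¹ − 1) e_a` if the index is in range, else `1`. -/
def ginvTot (a : ℕ) : B 𝕜 n q :=
  if h : a + 1 < n then q⁻¹ • g 𝕜 n q a h + (q⁻¹ - 1) • e 𝕜 n q a h else 1

/-- `e_{ab} = g_{b-1} ⋯ g_{a+1} e_a g_{a+1}⁻¹ ⋯ g_{b-1}⁻¹` for `a < b` (0-based). -/
def eabN (a b : ℕ) : B 𝕜 n q :=
  ((((List.range (b - 1 - a)).map (fun i => a + 1 + i)).reverse).map (gTot 𝕜 n q)).prod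
    * eTot 𝕜 n q a
    * (((List.range (b - 1 - a)).map (fun i => a + 1 + i)).map (ginvTot 𝕜 n q)).prod

/-- `e_{ab}`, symmetrized so that `e_{ba} = e_{ab}`. -/
def eab (a b : Fin n) : B 𝕜 n q :=
  if (a : ℕ) ≤ (b : ℕ) then eabN 𝕜 n q a b else eabN 𝕜 n q b a

/-- `e(A) = ∏_{a ∼_A b, a ≠ b} e_{ab}` (the factors commute, so the product may be taken
in any fixed order). -/
def eSet (A : Setoid (Fin n)) : B 𝕜 n q :=
  (((List.finRange n) ×ˢ (List.finRange n)).map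
    (fun p => if A.r p.1 p.2 ∧ p.1 ≠ p.2 then eab 𝕜 n q p.1 p.2 else 1)).prod

/-- The number of blocks of a set partition. -/
def nblocks (A : Setoid (Fin n)) : ℕ := Nat.card (Quotient A)

/-- The number of blocks of `A` contained in the block `c` of `B` (when `A ≤ B`). -/
def mcount (A B : Setoid (Fin n)) (c : Quotient B) : ℕ :=
  Nat.card {dA : Quotient A // B.r dA.out c.out}

/-- The Möbius function of the poset `(SetPar_n, ⊆)`:
`μ(A,B) = (−1)^{r−s} ∏_{i=1}^{r−1} (i!)^{r_{i+1}}` if `A ⊆ B` and `0` otherwise, where `r, s`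
are the numbers of blocks of `A, B` and `r_i` is the number of blocks of `B` containing
exactly `i` blocks of `A`. -/
def mob (A B : Setoid (Fin n)) : ℤ :=
  if A ≤ B then
    (-1 : ℤ) ^ (nblocks n A - nblocks n B) *
      ∏ i ∈ Finset.Icc 1 (nblocks n A - 1),
        (Nat.factorial i : ℤ) ^ (Nat.card {c : Quotient B // mcount n A B c = i + 1})
  else 0

instance : Finite (Setoid (Fin n)) :=
  Finite.of_injective (fun A : Setoid (Fin n) => A.r)
    (fun A B h => by cases A; cases B; simp only at h; subst h; rfl)

noncomputable instance : Fintype (Setoid (Fin n)) := Fintype.ofFinite _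

/-- `ē(A) = Σ_{B ⊇ A} μ(A,B) e(B)`. -/
def ebar (A : Setoid (Fin n)) : B 𝕜 n q :=
  ∑ C ∈ Finset.univ.filter (fun C : Setoid (Fin n) => A ≤ C),
    mob n A C • eSet 𝕜 n q C

/-- The action of a permutation on set partitions. -/
def permSetoid (σ : Equiv.Perm (Fin n)) (A : Setoid (Fin n)) : Setoid (Fin n) where
  r x y := A.r (σ.symm x) (σ.symm y)
  iseqv := ⟨fun _ => A.iseqv.refl _, fun h => A.iseqv.symm h, fun h h' => A.iseqv.trans h h'⟩

end BT

namespace BTP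

/-- Generators of the algebra `E′_n(q)` (0-based indexing). -/
inductive Gen (n : ℕ) : Type
  | g : (a : ℕ) → a + 1 < n → Gen n
  | eb : Setoid (Fin n) → Gen n

variable (𝕜 : Type) [Field 𝕜] (n : ℕ) (q : 𝕜)

abbrev F : Type := FreeAlgebra 𝕜 (Gen n)

def G (a : ℕ) (h : a + 1 < n) : F 𝕜 n := FreeAlgebra.ι 𝕜 (Gen.g a h)

def EB (A : Setoid (Fin n)) : F 𝕜 n := FreeAlgebra.ι 𝕜 (Gen.eb A)

/-- The defining relations of `E′_n(q)`. -/
inductive Rel : F 𝕜 n → F 𝕜 n → Prop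
  | unit : Rel (∑ A : Setoid (Fin n), EB 𝕜 n A) 1
  | orth (A C : Setoid (Fin n)) :
      Rel (EB 𝕜 n A * EB 𝕜 n C) (if A = C then EB 𝕜 n A else 0)
  | gmove (a : ℕ) (h : a + 1 < n) (A : Setoid (Fin n)) :
      Rel (G 𝕜 n a h * EB 𝕜 n A) (EB 𝕜 n (BT.permSetoid n (BT.sw n a h) A) * G 𝕜 n a h)
  | sqn (a : ℕ) (h : a + 1 < n) (A : Setoid (Fin n))
      (hA : ¬ A.r ⟨a, by omega⟩ ⟨a + 1, h⟩) :
      Rel (G 𝕜 n a h ^ 2 * EB 𝕜 n A) (q • EB 𝕜 n A)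
  | sqy (a : ℕ) (h : a + 1 < n) (A : Setoid (Fin n))
      (hA : A.r ⟨a, by omega⟩ ⟨a + 1, h⟩) :
      Rel (G 𝕜 n a h ^ 2 * EB 𝕜 n A)
        ((algebraMap 𝕜 (F 𝕜 n) q + (q - 1) • G 𝕜 n a h) * EB 𝕜 n A)
  | braid (a : ℕ) (h : a + 2 < n) :
      Rel (G 𝕜 n a (by omega) * G 𝕜 n (a + 1) h * G 𝕜 n a (by omega))
        (G 𝕜 n (a + 1) h * G 𝕜 n a (by omega) * G 𝕜 n (a + 1) h)
  | gfar (a b : ℕ) (ha : a + 1 < n) (hb : b + 1 < n) (hab : a + 1 < b) :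
      Rel (G 𝕜 n a ha * G 𝕜 n b hb) (G 𝕜 n b hb * G 𝕜 n a ha)

/-- The algebra `E′_n(q)`. -/
abbrev E : Type := RingQuot (Rel 𝕜 n q)

def π : F 𝕜 n →ₐ[𝕜] E 𝕜 n q := RingQuot.mkAlgHom 𝕜 (Rel 𝕜 n q)

def g (a : ℕ) (h : a + 1 < n) : E 𝕜 n q := π 𝕜 n q (G 𝕜 n a h)

def ebar (A : Setoid (Fin n)) : E 𝕜 n q := π 𝕜 n q (EB 𝕜 n A)

/-- The set partition `A_a` whose only non-singleton block is `{a, a+1}`. -/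
def pairSetoid (n : ℕ) (a : ℕ) (h : a + 1 < n) : Setoid (Fin n) :=
  Setoid.ker (fun x : Fin n =>
    if x = (⟨a + 1, h⟩ : Fin n) then (⟨a, by omega⟩ : Fin n) else x)

end BTP

/-- Units `g a` and elements `e a` of a ring, for `a + 1 < n`, satisfying the consequences of the
bt-algebra relations that govern the conjugation action of the `g a` on the `e a`. -/
structure IsBraidTie {R : Type*} [Ring R] (n : ℕ) (g : ℕ → Rˣ) (e : ℕ → R) : Prop where
  braid : ∀ a, a + 2 < n → g a * g (a + 1) * g a = g (a + 1) * g a * g (a + 1)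
  g_comm : ∀ a b, a + 1 < b → b + 1 < n → Commute (g a : R) (g b)
  g_comm_e : ∀ a b, a + 1 < n → b + 1 < n → a + 1 ≠ b → b + 1 ≠ a → Commute (g a : R) (e b)
  g_comm_e_self : ∀ a, a + 1 < n → Commute (g a : R) (e a)
  slide : ∀ a, a + 2 < n → SemiconjBy ((g a : R) * g (a + 1)) (e a) (e (a + 1))
  sq_comm : ∀ a b, a + 1 < n → b + 1 < n → (b = a + 1 ∨ a = b + 1) →
    Commute ((g a : R) * g a) (e b)
  e_comm : ∀ a b, a + 1 < n → b + 1 < n → Commute (e a) (e b)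
  e_idem : ∀ a, a + 1 < n → e a * e a = e a
  absorb : ∀ a, a + 2 < n →
    e a * ((g (a + 1) : R) * e a * ((g (a + 1))⁻¹ : Rˣ)) = e a * e (a + 1)

namespace IsBraidTie

variable {R : Type*} [Ring R] {n : ℕ} {g : ℕ → Rˣ} {e : ℕ → R}

/-- The tie between `i` and `i + d + 1`, obtained from `e i` by conjugation. -/
def tieAt (g : ℕ → Rˣ) (e : ℕ → R) (i : ℕ) : ℕ → R
  | 0 => e i
  | d + 1 => g (i + d + 1) * tieAt g e i d * ((g (i + d + 1))⁻¹ : Rˣ)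

theorem semiconjBy_tieAt_succ (g : ℕ → Rˣ) (e : ℕ → R) (i d : ℕ) :
    SemiconjBy (g (i + d + 1) : R) (tieAt g e i d) (tieAt g e i (d + 1)) :=
  Units.mk_semiconjBy _ _

/-- An element that commutes with a unit `u` transports along conjugation by `u`. -/
theorem _root_.SemiconjBy.conj_unit {M : Type*} [Monoid M] {u : Mˣ} {a x x' y y' : M}
    (hx : SemiconjBy (u : M) x x') (hy : SemiconjBy (u : M) y y')
    (ha : Commute a (u : M)) (h : SemiconjBy a x y) : SemiconjBy a x' y' := by
  have key : SemiconjBy ((u : M) * a) x y' := hy.mul_left h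
  have key' : SemiconjBy (a * (u : M) * ((u⁻¹ : Mˣ) : M)) x' y' :=
    SemiconjBy.mul_left (by rw [ha.eq]; exact key) hx.units_inv_symm_left
  simpa using key'

theorem _root_.SemiconjBy.cancel_unit {M : Type*} [Monoid M] {u : Mˣ} {a x y z : M}
    (hu : SemiconjBy (u : M) x y) (h : SemiconjBy (a * (u : M)) x z) : SemiconjBy a y z := by
  simpa [mul_assoc] using h.mul_left hu.units_inv_symm_left

theorem commute_above (H : IsBraidTie n g e) {a i d : ℕ} (ha : a + 1 < n) (h : i + d + 1 < a) :
    Commute (g a : R) (tieAt g e i d) := by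
  induction d with
  | zero => exact H.g_comm_e a i ha (by omega) (by omega) (by omega)
  | succ d ih =>
    have hs := semiconjBy_tieAt_succ g e i d
    exact hs.conj_unit hs (H.g_comm _ _ (by omega) ha).symm (ih (by omega))

theorem commute_below (H : IsBraidTie n g e) {a i d : ℕ} (h : a + 1 < i) (hd : i + d + 1 < n) :
    Commute (g a : R) (tieAt g e i d) := by
  induction d with
  | zero => exact H.g_comm_e a i (by omega) (by omega) (by omega) (by omega)
  | succ d ih =>
    have hs := semiconjBy_tieAt_succ g e i d
    exact hs.conj_unit hs (H.g_comm _ _ (by omega) (by omega)) (ih (by omega))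

theorem commute_between (H : IsBraidTie n g e) {a i d : ℕ} (hi : i < a) (h : a < i + d)
    (hd : i + d + 1 < n) : Commute (g a : R) (tieAt g e i d) := by
  induction d with
  | zero => omega
  | succ d ih =>
    have hs := semiconjBy_tieAt_succ g e i d
    rcases Nat.lt_or_ge a (i + d) with hlt | hge
    · exact hs.conj_unit hs (H.g_comm _ _ (by omega) (by omega)) (ih hlt (by omega))
    · obtain ⟨c, rfl⟩ : ∃ c, d = c + 1 := ⟨d - 1, by omega⟩
      obtain rfl : a = i + c + 1 := by omega
      have hs' := semiconjBy_tieAt_succ g e i c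
      have hcomm : Commute (g (i + c + 1 + 1) : R) (tieAt g e i c) :=
        H.commute_above (by omega) (by omega)
      have h3 : SemiconjBy ((g (i + c + 1 + 1) * g (i + c + 1) * g (i + c + 1 + 1) : Rˣ) : R)
          (tieAt g e i c) (tieAt g e i (c + 1 + 1)) := by
        push_cast
        exact (hs.mul_left hs').mul_left hcomm
      refine SemiconjBy.cancel_unit (u := g (i + c + 1 + 1) * g (i + c + 1)) (x := tieAt g e i c) ?_ ?_
      · push_cast
        exact hs.mul_left hs'
      · rw [← Units.val_mul, ← mul_assoc, H.braid _ (by omega)]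
        exact h3

theorem semiconjBy_low (H : IsBraidTie n g e) {i d : ℕ} (hd : i + d + 2 < n) :
    SemiconjBy (g i : R) (tieAt g e i (d + 1)) (tieAt g e (i + 1) d) := by
  induction d with
  | zero => exact (semiconjBy_tieAt_succ g e i 0).cancel_unit (H.slide i hd)
  | succ d ih =>
    have hx := semiconjBy_tieAt_succ g e i (d + 1)
    have hy := semiconjBy_tieAt_succ g e (i + 1) d
    rw [show i + 1 + d + 1 = i + (d + 1) + 1 by omega] at hy
    exact hx.conj_unit hy (H.g_comm _ _ (by omega) (by omega)) (ih (by omega))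

theorem sq_commute_low (H : IsBraidTie n g e) {a d : ℕ} (hd : a + d + 2 < n) :
    Commute ((g a : R) * g a) (tieAt g e (a + 1) d) := by
  induction d with
  | zero => exact H.sq_comm a (a + 1) (by omega) (by omega) (by omega)
  | succ d ih =>
    have hs := semiconjBy_tieAt_succ g e (a + 1) d
    have hg : Commute (g a : R) (g (a + 1 + d + 1)) := H.g_comm _ _ (by omega) (by omega)
    exact hs.conj_unit hs (hg.mul_left hg) (ih (by omega))

theorem sq_commute_high (H : IsBraidTie n g e) {i d : ℕ} (hd : i + d + 2 < n) :
    Commute ((g (i + d + 1) : R) * g (i + d + 1)) (tieAt g e i d) := by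
  induction d generalizing i with
  | zero => exact H.sq_comm (i + 1) i (by omega) (by omega) (by omega)
  | succ d ih =>
    have hs := (H.semiconjBy_low (i := i) (d := d) (by omega)).units_inv_symm_left
    have hg : Commute (g (i + (d + 1) + 1) : R) ((g i)⁻¹ : Rˣ) :=
      (H.g_comm _ _ (by omega) (by omega)).symm.units_inv_right
    have h := ih (i := i + 1) (by omega)
    rw [show i + 1 + d + 1 = i + (d + 1) + 1 by omega] at h
    exact hs.conj_unit hs (hg.mul_left hg) h

/-- The tie between `x` and `y`, with value `1` if `x = y`. -/
def tie (g : ℕ → Rˣ) (e : ℕ → R) (x y : ℕ) : R :=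
  if x < y then tieAt g e x (y - x - 1) else if y < x then tieAt g e y (x - y - 1) else 1

theorem tie_self (x : ℕ) : tie g e x x = 1 := by simp [tie]

theorem tie_comm (x y : ℕ) : tie g e x y = tie g e y x := by
  unfold tie; split_ifs <;> first | rfl | omega

theorem tie_add (x d : ℕ) : tie g e x (x + d + 1) = tieAt g e x d := by
  rw [tie, if_pos (by omega)]; congr 1; omega

theorem semiconjBy_of_sq {M : Type*} [Monoid M] {u : Mˣ} {x y : M} (h : SemiconjBy (u : M) x y)
    (hsq : Commute ((u : M) * u) y) : SemiconjBy (u : M) y x := by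
  simpa [← mul_assoc] using h.units_inv_symm_left.mul_left hsq

theorem semiconjBy_tie (H : IsBraidTie n g e) {a x y : ℕ} (ha : a + 1 < n) (hx : x < n)
    (hy : y < n) : SemiconjBy (g a : R) (tie g e x y)
      (tie g e (Equiv.swap a (a + 1) x) (Equiv.swap a (a + 1) y)) := by
  wlog hxy : x < y generalizing x y
  · rcases Nat.lt_or_ge y x with h | h
    · rw [tie_comm x, tie_comm (Equiv.swap a (a + 1) x)]
      exact this hy hx h
    · obtain rfl : x = y := by omega
      simp [tie_self]
  obtain ⟨d, rfl⟩ : ∃ d, y = x + d + 1 := ⟨y - x - 1, by omega⟩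
  rw [tie_add]
  have fixed (z : ℕ) (h1 : z ≠ a) (h2 : z ≠ a + 1) : Equiv.swap a (a + 1) z = z :=
    Equiv.swap_apply_of_ne_of_ne h1 h2
  by_cases hxa : x = a
  · subst hxa
    rw [Equiv.swap_apply_left]
    cases d with
    | zero =>
      rw [Equiv.swap_apply_right, tie_comm, show tie g e x (x + 1) = e x from tie_add x 0]
      exact H.g_comm_e_self x ha
    | succ d =>
      rw [fixed _ (by omega) (by omega), show x + (d + 1) + 1 = x + 1 + d + 1 by omega, tie_add]
      exact H.semiconjBy_low (by omega)
  by_cases hxa' : x = a + 1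
  · subst hxa'
    rw [Equiv.swap_apply_right, fixed _ (by omega) (by omega),
      show a + 1 + d + 1 = a + (d + 1) + 1 by omega, tie_add]
    exact semiconjBy_of_sq (H.semiconjBy_low (by omega)) (H.sq_commute_low (by omega))
  rw [fixed x hxa hxa']
  by_cases hya : x + d + 1 = a
  · subst hya
    rw [Equiv.swap_apply_left, show x + d + 1 + 1 = x + (d + 1) + 1 by omega, tie_add]
    exact semiconjBy_tieAt_succ g e x d
  by_cases hya' : x + d + 1 = a + 1
  · obtain ⟨c, rfl⟩ : ∃ c, d = c + 1 := ⟨d - 1, by omega⟩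
    obtain rfl : a = x + c + 1 := by omega
    rw [show x + (c + 1) + 1 = x + c + 1 + 1 by omega, Equiv.swap_apply_right, tie_add]
    refine semiconjBy_of_sq (semiconjBy_tieAt_succ g e x c) ?_
    have hs := semiconjBy_tieAt_succ g e x c
    exact hs.conj_unit hs ((Commute.refl _).mul_left (Commute.refl _))
      (H.sq_commute_high (by omega))
  rw [fixed _ hya hya', tie_add]
  rcases Nat.lt_or_ge (x + d + 1) a with h | h
  · exact H.commute_above ha h
  rcases Nat.lt_or_ge (a + 1) x with h' | h'
  · exact H.commute_below h' (by omega)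
  · exact H.commute_between (by omega) (by omega) (by omega)

/-- The adjacent transpositions act on ties by conjugation, so every permutation does. -/
theorem exists_unit_semiconjBy (H : IsBraidTie n g e) (σ : Equiv.Perm (Fin n)) :
    ∃ u : Rˣ, ∀ x y : Fin n, SemiconjBy (u : R) (tie g e x y) (tie g e (σ x) (σ y)) := by
  cases n with
  | zero => exact ⟨1, fun x => x.elim0⟩
  | succ m =>
    have hσ : σ ∈ Submonoid.closure (Set.range fun i : Fin m ↦ Equiv.swap i.castSucc i.succ) := by
      rw [Equiv.Perm.mclosure_swap_castSucc_succ]; trivial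
    induction hσ using Submonoid.closure_induction with
    | mem τ hτ =>
      obtain ⟨i, rfl⟩ := hτ
      refine ⟨g i, fun x y => ?_⟩
      have hval (z : Fin (m + 1)) : ((Equiv.swap i.castSucc i.succ z : Fin (m + 1)) : ℕ) =
          Equiv.swap (i : ℕ) (i + 1) z := by
        simp only [Equiv.swap_apply_def, Fin.ext_iff]
        split_ifs <;> simp_all
      rw [hval, hval]
      exact H.semiconjBy_tie (by omega) x.2 y.2
    | one => exact ⟨1, fun x y => by simp⟩
    | mul σ τ _ _ hσ hτ =>
      obtain ⟨u, hu⟩ := hσ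
      obtain ⟨v, hv⟩ := hτ
      exact ⟨u * v, fun x y => by
        push_cast
        exact (hu _ _).mul_left (hv x y)⟩

theorem le_of_injective_fin {k : ℕ} {x : Fin k → Fin n} (hx : Function.Injective x) : k ≤ n := by
  simpa using Fintype.card_le_of_injective x hx

/-- Any `k` distinct indices are the images of the first `k` indices under a unit that conjugates
ties accordingly. -/
theorem exists_unit_of_injective (H : IsBraidTie n g e) {k : ℕ} {x : Fin k → Fin n}
    (hx : Function.Injective x) :
    ∃ u : Rˣ, ∀ i j : Fin k, SemiconjBy (u : R) (tie g e i j) (tie g e (x i) (x j)) := by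
  obtain ⟨σ, hσ⟩ := Equiv.Perm.exists_extending_pair (Fin.castLE (le_of_injective_fin hx)) x
    (Fin.castLE_injective _) hx
  obtain ⟨u, hu⟩ := H.exists_unit_semiconjBy σ
  refine ⟨u, fun i j => ?_⟩
  have h := hu (Fin.castLE (le_of_injective_fin hx) i) (Fin.castLE (le_of_injective_fin hx) j)
  rw [hσ, hσ] at h
  exact h

theorem _root_.SemiconjBy.eq_of_unit {M : Type*} [Monoid M] {u : Mˣ} {x x' y' : M}
    (hx : SemiconjBy (u : M) x x') (hy : SemiconjBy (u : M) x y') : x' = y' :=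
  (Units.mul_left_inj u).1 (hx.eq.symm.trans hy.eq)

theorem _root_.SemiconjBy.commute_unit {M : Type*} [Monoid M] {u : Mˣ} {x y x' y' : M}
    (hx : SemiconjBy (u : M) x x') (hy : SemiconjBy (u : M) y y') (h : Commute x y) :
    Commute x' y' := by
  have h1 := hx.mul_right hy
  rw [h.eq] at h1
  exact h1.eq_of_unit (hy.mul_right hx)

theorem tie_idem (H : IsBraidTie n g e) (x y : Fin n) :
    tie g e x y * tie g e x y = tie g e x y := by
  by_cases hxy : x = y
  · simp [hxy, tie_self]
  have hinj : Function.Injective ![x, y] := by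
    intro i j hij; fin_cases i <;> fin_cases j <;> simp_all
  obtain ⟨u, hu⟩ := H.exists_unit_of_injective hinj
  have hn := le_of_injective_fin hinj
  have h := hu 0 1
  have h0 : tie g e ((0 : Fin 2) : ℕ) ((1 : Fin 2) : ℕ) = e 0 := tie_add 0 0
  rw [h0] at h
  have h' := h.mul_right h
  rw [H.e_idem 0 (by omega)] at h'
  exact h'.eq_of_unit h

theorem tie_adjacent (H : IsBraidTie n g e) {x y z : Fin n} (hxy : x ≠ y) (hyz : y ≠ z)
    (hxz : x ≠ z) : Commute (tie g e x y) (tie g e y z) ∧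
      tie g e x y * tie g e x z = tie g e x y * tie g e y z := by
  have hinj : Function.Injective ![x, y, z] := by
    intro i j hij; fin_cases i <;> fin_cases j <;> simp_all
  obtain ⟨u, hu⟩ := H.exists_unit_of_injective hinj
  have hn := le_of_injective_fin hinj
  have h01 := hu 0 1
  have h12 := hu 1 2
  have h02 := hu 0 2
  have e01 : tie g e ((0 : Fin 3) : ℕ) ((1 : Fin 3) : ℕ) = e 0 := tie_add 0 0
  have e12 : tie g e ((1 : Fin 3) : ℕ) ((2 : Fin 3) : ℕ) = e 1 := tie_add 1 0
  have e02 : tie g e ((0 : Fin 3) : ℕ) ((2 : Fin 3) : ℕ) =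
    g 1 * e 0 * ((g 1)⁻¹ : Rˣ) := tie_add 0 1
  rw [e01] at h01
  rw [e12] at h12
  rw [e02] at h02
  refine ⟨h01.commute_unit h12 (H.e_comm _ _ (by omega) (by omega)), ?_⟩
  have h := h01.mul_right h02
  rw [H.absorb 0 (by omega)] at h
  exact h.eq_of_unit (h01.mul_right h12)

theorem tie_commute (H : IsBraidTie n g e) (x y z w : Fin n) :
    Commute (tie g e x y) (tie g e z w) := by
  by_cases hxy : x = y
  · rw [hxy, tie_self]; exact Commute.one_left _
  by_cases hzw : z = w
  · rw [hzw, tie_self]; exact Commute.one_right _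
  by_cases hxz : x = z
  · subst hxz
    by_cases hyw : y = w
    · subst hyw; exact Commute.refl _
    rw [tie_comm x y]
    exact (H.tie_adjacent (Ne.symm hxy) hzw hyw).1
  by_cases hxw : x = w
  · subst hxw
    by_cases hyz : y = z
    · subst hyz; rw [tie_comm]
    rw [tie_comm x y, tie_comm z x]
    exact (H.tie_adjacent (Ne.symm hxy) hxz hyz).1
  by_cases hyz : y = z
  · subst hyz
    exact (H.tie_adjacent hxy hzw hxw).1
  by_cases hyw : y = w
  · subst hyw
    rw [tie_comm z y]
    exact (H.tie_adjacent hxy hyz hxz).1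
  have hinj : Function.Injective ![x, y, z, w] := by
    intro i j hij; fin_cases i <;> fin_cases j <;> simp_all
  obtain ⟨u, hu⟩ := H.exists_unit_of_injective hinj
  have hn := le_of_injective_fin hinj
  have h01 := hu 0 1
  have h23 := hu 2 3
  have e01 : tie g e ((0 : Fin 4) : ℕ) ((1 : Fin 4) : ℕ) = e 0 := tie_add 0 0
  have e23 : tie g e ((2 : Fin 4) : ℕ) ((3 : Fin 4) : ℕ) = e 2 := tie_add 2 0
  rw [e01] at h01
  rw [e23] at h23
  exact h01.commute_unit h23 (H.e_comm _ _ (by omega) (by omega))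

theorem tie_trans (H : IsBraidTie n g e) (x y z : Fin n) :
    tie g e x y * tie g e y z * tie g e x z = tie g e x y * tie g e y z := by
  by_cases hxy : x = y
  · subst hxy; rw [tie_self, one_mul, H.tie_idem]
  by_cases hyz : y = z
  · subst hyz; rw [tie_self, mul_one, H.tie_idem]
  by_cases hxz : x = z
  · subst hxz; rw [tie_self, mul_one]
  obtain ⟨hc, ht⟩ := H.tie_adjacent hxy hyz hxz
  rw [hc.eq, mul_assoc, ht, ← mul_assoc, ← hc.eq, mul_assoc, H.tie_idem]

end IsBraidTie

/-- The product over all pairs `(x, y)` of `T x y` or `1 - T x y`, according to whether `A x y`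
holds. -/
def relIdem {ι K : Type*} [Fintype ι] [CommRing K] (T : ι → ι → K) (A : ι → ι → Prop) : K :=
  ∏ p : ι × ι, if A p.1 p.2 then T p.1 p.2 else 1 - T p.1 p.2

section RelIdem

variable {ι K : Type*} [Fintype ι] [CommRing K] {T : ι → ι → K} {A C : ι → ι → Prop}

theorem mul_relIdem (hT : ∀ x y, T x y * T x y = T x y) (A : ι → ι → Prop) (x y : ι) :
    T x y * relIdem T A = if A x y then relIdem T A else 0 := by
  rw [relIdem, ← Finset.mul_prod_erase Finset.univ _ (Finset.mem_univ (x, y)), ← mul_assoc]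
  split_ifs with h
  · rw [hT]
  · rw [mul_sub, mul_one, hT, sub_self, zero_mul]

theorem relIdem_mul_self (hT : ∀ x y, T x y * T x y = T x y) (A : ι → ι → Prop) :
    relIdem T A * relIdem T A = relIdem T A := by
  rw [relIdem, ← Finset.prod_mul_distrib]
  refine Finset.prod_congr rfl fun p _ => ?_
  split_ifs
  · exact hT _ _
  · linear_combination hT p.1 p.2

theorem relIdem_mul_of_ne (hT : ∀ x y, T x y * T x y = T x y) (h : A ≠ C) :
    relIdem T A * relIdem T C = 0 := by
  obtain ⟨x, y, hxy⟩ : ∃ x y, ¬(A x y ↔ C x y) := by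
    by_contra! hAC
    exact h (funext₂ fun x y => propext (hAC x y))
  have hA := mul_relIdem hT A x y
  have hC := mul_relIdem hT C x y
  by_cases hAx : A x y
  · have hCx : ¬C x y := fun hc => hxy ⟨fun _ => hc, fun _ => hAx⟩
    rw [if_pos hAx] at hA
    rw [if_neg hCx] at hC
    rw [← hA]
    linear_combination relIdem T A * hC
  · have hCx : C x y := by tauto
    rw [if_neg hAx] at hA
    rw [if_pos hCx] at hC
    rw [← hC]
    linear_combination relIdem T C * hA

theorem relIdem_eq_zero (hT : ∀ x y, T x y * T x y = T x y) (hrefl : ∀ x, T x x = 1)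
    (hsymm : ∀ x y, T x y = T y x) (htrans : ∀ x y z, T x y * T y z * T x z = T x y * T y z)
    (hA : ¬Equivalence A) : relIdem T A = 0 := by
  by_contra hne
  refine hA ⟨fun x => ?_, fun {x y} hxy => ?_, fun {x y z} hxy hyz => ?_⟩ <;> by_contra hnot
  · have h := mul_relIdem hT A x x
    rw [if_neg hnot, hrefl, one_mul] at h
    exact hne h
  · have h := mul_relIdem hT A y x
    have h' := mul_relIdem hT A x y
    rw [if_neg hnot, hsymm] at h
    rw [if_pos hxy] at h'
    exact hne (h'.symm.trans h)
  · have h1 := mul_relIdem hT A x y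
    have h2 := mul_relIdem hT A y z
    have h3 := mul_relIdem hT A x z
    rw [if_pos hxy] at h1
    rw [if_pos hyz] at h2
    rw [if_neg hnot] at h3
    refine hne ?_
    linear_combination -h1 - T x y * h2 + T x y * T y z * h3 - relIdem T A * htrans x y z

theorem sum_relIdem_setoid [Fintype (Setoid ι)] (hT : ∀ x y, T x y * T x y = T x y)
    (hrefl : ∀ x, T x x = 1) (hsymm : ∀ x y, T x y = T y x)
    (htrans : ∀ x y z, T x y * T y z * T x z = T x y * T y z) :
    ∑ A : Setoid ι, relIdem T A.r = 1 := by
  have h1 : ∑ s : ι × ι → Prop, relIdem T (fun x y => s (x, y)) = 1 := by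
    have h := Finset.prod_univ_sum (fun _ : ι × ι => (Finset.univ : Finset Prop))
      (fun p P => if P then T p.1 p.2 else 1 - T p.1 p.2)
    rw [Fintype.piFinset_univ] at h
    simp only [relIdem]
    rw [← h]
    exact Finset.prod_eq_one fun p _ => by simp
  rw [← h1]
  refine Fintype.sum_of_injective (fun (A : Setoid ι) (p : ι × ι) => A.r p.1 p.2) ?_ _ _ ?_ ?_
  · intro A C h
    exact Setoid.ext fun x y => iff_of_eq (congrFun h (x, y))
  · intro s hs
    refine relIdem_eq_zero hT hrefl hsymm htrans fun hE => hs ⟨⟨_, hE⟩, rfl⟩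
  · intro A; rfl

theorem map_relIdem {K' : Type*} [CommRing K'] (φ : K →+* K') (T : ι → ι → K)
    (A : ι → ι → Prop) : φ (relIdem T A) = relIdem (fun x y => φ (T x y)) A := by
  simp only [relIdem, map_prod]
  exact Finset.prod_congr rfl fun p _ => by split_ifs <;> simp

theorem relIdem_perm (σ : Equiv.Perm ι) (T : ι → ι → K) (A : ι → ι → Prop) :
    relIdem (fun x y => T (σ x) (σ y)) A = relIdem T (fun x y => A (σ.symm x) (σ.symm y)) := by
  refine Fintype.prod_equiv (σ.prodCongr σ) _ _ fun p => ?_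
  simp

end RelIdem

theorem map_relIdem_mul {ι K S : Type*} [Fintype ι] [CommRing K] [Ring S] (ψ : K →+* S)
    {T : ι → ι → K} {c : S} {C : ι → ι → Prop}
    (h : ∀ x y, ψ (T x y) * c = if C x y then c else 0) (A : ι → ι → Prop) :
    ψ (relIdem T A) * c = if A = C then c else 0 := by
  have key (s : Finset (ι × ι)) :
      ψ (∏ p ∈ s, if A p.1 p.2 then T p.1 p.2 else 1 - T p.1 p.2) * c =
        if ∀ p ∈ s, (A p.1 p.2 ↔ C p.1 p.2) then c else 0 := by
    induction s using Finset.induction_on with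
    | empty => simp
    | insert p s hp ih =>
      have hp' : ψ (if A p.1 p.2 then T p.1 p.2 else 1 - T p.1 p.2) * c =
          if (A p.1 p.2 ↔ C p.1 p.2) then c else 0 := by
        by_cases hA : A p.1 p.2 <;> by_cases hC : C p.1 p.2 <;> simp [hA, hC, sub_mul, h]
      rw [Finset.prod_insert hp, map_mul, mul_assoc, ih]
      simp only [Finset.forall_mem_insert]
      split_ifs <;> simp_all
  rw [relIdem, key]
  refine if_congr ⟨fun hAC => funext₂ fun x y => propext (hAC (x, y) (Finset.mem_univ _)), ?_⟩
    rfl rfl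
  rintro rfl p _
  rfl

namespace IsBraidTie

variable {R : Type*} [Ring R] {n : ℕ} {g : ℕ → Rˣ} {e : ℕ → R}

/-- The subring generated by all ties between elements of `Fin n`. -/
def tieRing (n : ℕ) (g : ℕ → Rˣ) (e : ℕ → R) : Subring R :=
  Subring.closure (Set.range fun p : Fin n × Fin n => tie g e p.1 p.2)

/-- The tie between `x` and `y`, as an element of the ring generated by all ties. -/
def tieElem (g : ℕ → Rˣ) (e : ℕ → R) (x y : Fin n) : tieRing n g e :=
  ⟨tie g e x y, Subring.subset_closure ⟨(x, y), rfl⟩⟩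

/-- Ties commute, so they generate a commutative ring. -/
abbrev tieCommRing (H : IsBraidTie n g e) : CommRing (tieRing n g e) :=
  { (tieRing n g e).toRing with
    mul_comm := by
      have := Subring.isMulCommutative_closure
        (s := Set.range fun p : Fin n × Fin n => tie g e p.1 p.2) (by
          rintro _ ⟨p, rfl⟩ _ ⟨r, rfl⟩
          exact (H.tie_commute _ _ _ _).eq)
      exact this.is_comm.comm }

/-- The idempotent attached to a set partition: the product of the ties inside blocks and of the
complements of the ties between different blocks. -/
def blockIdem (H : IsBraidTie n g e) (A : Setoid (Fin n)) : R :=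
  letI := H.tieCommRing
  (relIdem (tieElem (n := n) g e) A.r : tieRing n g e)

theorem tieElem_idem (H : IsBraidTie n g e) (x y : Fin n) :
    tieElem g e x y * tieElem g e x y = tieElem g e x y :=
  Subtype.ext (H.tie_idem x y)

theorem sum_blockIdem (H : IsBraidTie n g e) : ∑ A : Setoid (Fin n), H.blockIdem A = 1 := by
  let _ := H.tieCommRing
  have h := sum_relIdem_setoid (T := tieElem (n := n) g e) H.tieElem_idem
    (fun x => Subtype.ext (tie_self _)) (fun x y => Subtype.ext (tie_comm _ _))
    (fun x y z => Subtype.ext (H.tie_trans x y z))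
  simpa [blockIdem] using congrArg (tieRing n g e).subtype h

theorem blockIdem_mul (H : IsBraidTie n g e) (A C : Setoid (Fin n)) :
    H.blockIdem A * H.blockIdem C = if A = C then H.blockIdem A else 0 := by
  let _ := H.tieCommRing
  split_ifs with h
  · subst h
    exact congrArg Subtype.val (relIdem_mul_self H.tieElem_idem A.r)
  · exact congrArg Subtype.val (relIdem_mul_of_ne (C := C.r) H.tieElem_idem
      fun hr => h (Setoid.ext fun x y => iff_of_eq (congrFun₂ hr x y)))

theorem tie_mul_blockIdem (H : IsBraidTie n g e) (A : Setoid (Fin n)) (x y : Fin n) :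
    tie g e x y * H.blockIdem A = if A.r x y then H.blockIdem A else 0 := by
  let _ := H.tieCommRing
  have h := congrArg Subtype.val (mul_relIdem H.tieElem_idem A.r x y)
  split_ifs with hA
  · rw [if_pos hA] at h; exact h
  · rw [if_neg hA] at h; exact h

theorem semiconjBy_blockIdem (H : IsBraidTie n g e) {u : Rˣ} {σ : Equiv.Perm (Fin n)}
    (hu : ∀ x y : Fin n, SemiconjBy (u : R) (tie g e x y) (tie g e (σ x) (σ y)))
    (A : Setoid (Fin n)) :
    SemiconjBy (u : R) (H.blockIdem A) (H.blockIdem (BT.permSetoid n σ A)) := by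
  let _ := H.tieCommRing
  let c : R →+* R := MulSemiringAction.toRingHom (ConjAct Rˣ) R (ConjAct.toConjAct u)
  have hc (r : R) : c r = u * r * ((u⁻¹ : Rˣ) : R) := rfl
  have hct (x y : Fin n) : c (tie g e x y) = tie g e (σ x) (σ y) := by
    rw [hc, (hu x y).eq, Units.mul_inv_cancel_right]
  have hmem : ∀ r ∈ tieRing n g e, c r ∈ tieRing n g e := by
    change tieRing n g e ≤ (tieRing n g e).comap c
    refine Subring.closure_le.2 ?_
    rintro _ ⟨p, rfl⟩
    change c _ ∈ tieRing n g e
    rw [hct]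
    exact Subring.subset_closure ⟨(σ p.1, σ p.2), rfl⟩
  have h := map_relIdem (c.restrict (tieRing n g e) (tieRing n g e) hmem) (tieElem g e) A.r
  have hT : (fun x y => c.restrict (tieRing n g e) (tieRing n g e) hmem (tieElem g e x y)) =
      fun x y => tieElem g e (σ x) (σ y) :=
    funext₂ fun x y => Subtype.ext (hct x y)
  rw [hT, relIdem_perm] at h
  have h' : c (H.blockIdem A) = H.blockIdem (BT.permSetoid n σ A) := congrArg Subtype.val h
  rw [← h', hc]
  exact Units.mk_semiconjBy _ _

theorem map_blockIdem_mul (H : IsBraidTie n g e) {S : Type*} [Ring S] (ψ : R →+* S) {c : S}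
    {C : Setoid (Fin n)}
    (h : ∀ x y : Fin n, ψ (tie g e x y) * c = if C.r x y then c else 0) (A : Setoid (Fin n)) :
    ψ (H.blockIdem A) * c = if A = C then c else 0 := by
  let _ := H.tieCommRing
  have key := map_relIdem_mul (ψ.comp (tieRing n g e).subtype) (T := tieElem (n := n) g e) h A.r
  refine Eq.trans key (if_congr ⟨fun hr => ?_, fun hr => hr ▸ rfl⟩ rfl rfl)
  exact Setoid.ext fun x y => iff_of_eq (congrFun₂ hr x y)

end IsBraidTie

namespace BT

variable (𝕜 : Type) [Field 𝕜] (n : ℕ) (q : 𝕜)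

variable {𝕜 n q} in
theorem π_eq_of_rel {x y : F 𝕜 n} (h : Rel 𝕜 n q x y) : π 𝕜 n q x = π 𝕜 n q y :=
  RingQuot.mkAlgHom_rel 𝕜 h

theorem g_mul_e (a : ℕ) (h : a + 1 < n) :
    g 𝕜 n q a h * e 𝕜 n q a h = e 𝕜 n q a h * g 𝕜 n q a h := by
  simpa using! π_eq_of_rel (Rel.ge (q := q) a h)

theorem g_mul_g (a : ℕ) (h : a + 1 < n) :
    g 𝕜 n q a h * g 𝕜 n q a h =
      algebraMap 𝕜 _ q + (q - 1) • (e 𝕜 n q a h * g 𝕜 n q a h) := by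
  simpa [pow_two] using! π_eq_of_rel (Rel.gsq (q := q) a h)

/-- The generator `g_a` as a unit, and `1` if the index is out of range. -/
def gUnit (hq0 : q ≠ 0) (a : ℕ) : (B 𝕜 n q)ˣ :=
  if h : a + 1 < n then
    { val := g 𝕜 n q a h
      inv := q⁻¹ • g 𝕜 n q a h + (q⁻¹ - 1) • e 𝕜 n q a h
      val_inv := by
        rw [mul_add, mul_smul_comm, mul_smul_comm, g_mul_g, g_mul_e, smul_add, smul_smul,
          Algebra.algebraMap_eq_smul_one, smul_smul, add_assoc, ← add_smul, mul_sub,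
          inv_mul_cancel₀ hq0]
        simp
      inv_val := by
        rw [add_mul, smul_mul_assoc, smul_mul_assoc, g_mul_g, smul_add, smul_smul,
          Algebra.algebraMap_eq_smul_one, smul_smul, add_assoc, ← add_smul, mul_sub,
          inv_mul_cancel₀ hq0]
        simp }
  else 1

variable {𝕜 n q}

theorem val_gUnit (hq0 : q ≠ 0) {a : ℕ} (h : a + 1 < n) :
    (gUnit 𝕜 n q hq0 a : B 𝕜 n q) = g 𝕜 n q a h := by
  rw [gUnit, dif_pos h]

theorem eTot_eq {a : ℕ} (h : a + 1 < n) : eTot 𝕜 n q a = e 𝕜 n q a h := by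
  rw [eTot, dif_pos h]

theorem e_mul_e_mul_g {a b : ℕ} (ha : a + 1 < n) (hb : b + 1 < n) (hab : b = a + 1 ∨ a = b + 1) :
    e 𝕜 n q a ha * e 𝕜 n q b hb * g 𝕜 n q b hb =
      e 𝕜 n q a ha * g 𝕜 n q b hb * e 𝕜 n q a ha := by
  simpa using! π_eq_of_rel (Rel.eeg1 (q := q) a b ha hb hab)

theorem e_mul_g_mul_e {a b : ℕ} (ha : a + 1 < n) (hb : b + 1 < n) (hab : b = a + 1 ∨ a = b + 1) :
    e 𝕜 n q a ha * g 𝕜 n q b hb * e 𝕜 n q a ha =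
      g 𝕜 n q b hb * e 𝕜 n q a ha * e 𝕜 n q b hb := by
  simpa using! π_eq_of_rel (Rel.eeg2 (q := q) a b ha hb hab)

theorem e_comm {a b : ℕ} (ha : a + 1 < n) (hb : b + 1 < n) :
    e 𝕜 n q a ha * e 𝕜 n q b hb = e 𝕜 n q b hb * e 𝕜 n q a ha := by
  simpa using! π_eq_of_rel (Rel.ee (q := q) a b ha hb)

theorem isBraidTie (hq0 : q ≠ 0) : IsBraidTie n (gUnit 𝕜 n q hq0) (eTot 𝕜 n q) where
  braid a h := by
    ext
    push_cast
    rw [val_gUnit hq0 (show a + 1 < n by omega), val_gUnit hq0 (show a + 1 + 1 < n from h)]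
    simpa using! π_eq_of_rel (Rel.braid (q := q) a h)
  g_comm a b hab hb := by
    rw [val_gUnit hq0 (show a + 1 < n by omega), val_gUnit hq0 hb]
    simpa using! π_eq_of_rel (Rel.gfar (q := q) a b (by omega) hb hab)
  g_comm_e a b ha hb hab hba := by
    rw [val_gUnit hq0 ha, eTot_eq hb]
    by_cases h : a = b
    · subst h
      exact g_mul_e 𝕜 n q a ha
    · simpa using! π_eq_of_rel (Rel.gefar (q := q) a b ha hb (by omega))
  g_comm_e_self a ha := by
    rw [val_gUnit hq0 ha, eTot_eq ha]
    exact g_mul_e 𝕜 n q a ha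
  slide a h := by
    have hb : a + 1 + 1 < n := h
    rw [val_gUnit hq0 (show a + 1 < n by omega), val_gUnit hq0 hb, eTot_eq (show a + 1 < n by omega),
      eTot_eq hb]
    have := π_eq_of_rel (Rel.egg (𝕜 := 𝕜) (q := q) (a + 1) a hb (by omega) (by omega))
    simp only [map_mul] at this
    exact this.symm.trans (mul_assoc _ _ _)
  sq_comm a b ha hb hab := by
    rw [val_gUnit hq0 ha, eTot_eq hb, g_mul_g, Algebra.algebraMap_eq_smul_one]
    refine ((Commute.one_left _).smul_left _).add_left (Commute.smul_left ?_ _)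
    have h1 := e_mul_e_mul_g (q := q) hb ha hab.symm
    have h2 := e_mul_g_mul_e (q := q) hb ha hab.symm
    rw [Commute, SemiconjBy, ← mul_assoc, h1, h2, mul_assoc (g 𝕜 n q a ha),
      e_comm hb ha, ← mul_assoc, g_mul_e]
  e_comm a b ha hb := by
    rw [eTot_eq ha, eTot_eq hb]
    exact e_comm ha hb
  e_idem a ha := by
    rw [eTot_eq ha]
    simpa using! π_eq_of_rel (Rel.esq (q := q) a ha)
  absorb a h := by
    have hb : a + 1 + 1 < n := h
    have h1 := e_mul_e_mul_g (𝕜 := 𝕜) (q := q) (show a + 1 < n by omega) hb (Or.inl rfl)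
    rw [eTot_eq (show a + 1 < n by omega), eTot_eq hb, ← mul_assoc, Units.mul_inv_eq_iff_eq_mul,
      val_gUnit hq0 hb, h1, mul_assoc]

end BT

namespace BTP

variable {𝕜 : Type} [Field 𝕜] {n : ℕ} {q : 𝕜}

theorem π_eq_of_rel {x y : F 𝕜 n} (h : Rel 𝕜 n q x y) : π 𝕜 n q x = π 𝕜 n q y :=
  RingQuot.mkAlgHom_rel 𝕜 h

theorem sum_ebar : ∑ A : Setoid (Fin n), ebar 𝕜 n q A = 1 := by
  simpa using! π_eq_of_rel (Rel.unit (𝕜 := 𝕜) (n := n) (q := q))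

theorem ebar_mul_ebar (A C : Setoid (Fin n)) :
    ebar 𝕜 n q A * ebar 𝕜 n q C = if A = C then ebar 𝕜 n q A else 0 := by
  have h := π_eq_of_rel (Rel.orth (𝕜 := 𝕜) (q := q) A C)
  rw [map_mul] at h
  refine h.trans ?_
  split_ifs
  · rfl
  · exact map_zero _

theorem semiconjBy_ebar (a : ℕ) (h : a + 1 < n) (A : Setoid (Fin n)) :
    SemiconjBy (g 𝕜 n q a h) (ebar 𝕜 n q A)
      (ebar 𝕜 n q (BT.permSetoid n (BT.sw n a h) A)) := by
  simpa using! π_eq_of_rel (Rel.gmove (𝕜 := 𝕜) (q := q) a h A)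

theorem ext_mul_ebar {x y : E 𝕜 n q} (h : ∀ C, x * ebar 𝕜 n q C = y * ebar 𝕜 n q C) : x = y := by
  rw [← mul_one x, ← mul_one y, ← sum_ebar, Finset.mul_sum, Finset.mul_sum]
  exact Finset.sum_congr rfl fun C _ => h C

variable (𝕜 n q) in
/-- The sum of the idempotents of all set partitions with `x` and `y` in the same block. -/
def link (x y : Fin n) : E 𝕜 n q :=
  ∑ C ∈ Finset.univ.filter (fun C : Setoid (Fin n) => C.r x y), ebar 𝕜 n q C

theorem link_mul_ebar (x y : Fin n) (C : Setoid (Fin n)) :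
    link 𝕜 n q x y * ebar 𝕜 n q C = if C.r x y then ebar 𝕜 n q C else 0 := by
  rw [link, Finset.sum_mul]
  simp only [ebar_mul_ebar, Finset.sum_ite_eq', Finset.mem_filter, Finset.mem_univ, true_and]

theorem link_mul_link_mul_ebar (x y z w : Fin n) (C : Setoid (Fin n)) :
    link 𝕜 n q x y * link 𝕜 n q z w * ebar 𝕜 n q C =
      if C.r x y ∧ C.r z w then ebar 𝕜 n q C else 0 := by
  rw [mul_assoc, link_mul_ebar]
  split_ifs <;> simp_all [link_mul_ebar]

theorem link_mul_link_congr {x y z w x' y' z' w' : Fin n}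
    (h : ∀ C : Setoid (Fin n), C.r x y ∧ C.r z w ↔ C.r x' y' ∧ C.r z' w') :
    link 𝕜 n q x y * link 𝕜 n q z w = link 𝕜 n q x' y' * link 𝕜 n q z' w' :=
  ext_mul_ebar fun C => by simp only [link_mul_link_mul_ebar, h]

theorem link_comm (x y : Fin n) : link 𝕜 n q x y = link 𝕜 n q y x :=
  ext_mul_ebar fun C => by
    rw [link_mul_ebar, link_mul_ebar]
    exact if_congr ⟨C.symm', C.symm'⟩ rfl rfl

theorem link_self (x : Fin n) : link 𝕜 n q x x = 1 :=
  ext_mul_ebar fun C => by rw [link_mul_ebar, if_pos (C.refl' x), one_mul]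

theorem link_mul_self (x y : Fin n) :
    link 𝕜 n q x y * link 𝕜 n q x y = link 𝕜 n q x y :=
  ext_mul_ebar fun C => by simp only [link_mul_link_mul_ebar, link_mul_ebar, and_self]

theorem permSetoid_apply (σ : Equiv.Perm (Fin n)) (C : Setoid (Fin n)) (x y : Fin n) :
    (BT.permSetoid n σ C).r (σ x) (σ y) ↔ C.r x y := by
  change C.r (σ.symm (σ x)) (σ.symm (σ y)) ↔ _
  rw [σ.symm_apply_apply, σ.symm_apply_apply]

theorem semiconjBy_link (a : ℕ) (h : a + 1 < n) (x y : Fin n) :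
    SemiconjBy (g 𝕜 n q a h) (link 𝕜 n q x y)
      (link 𝕜 n q (BT.sw n a h x) (BT.sw n a h y)) :=
  ext_mul_ebar fun C => by
    rw [mul_assoc, mul_assoc, link_mul_ebar, (semiconjBy_ebar a h C).eq, ← mul_assoc,
      link_mul_ebar, if_congr (permSetoid_apply _ C x y) rfl rfl]
    split_ifs
    · exact (semiconjBy_ebar a h C).eq
    · simp

theorem pairSetoid_le_iff {a : ℕ} {h : a + 1 < n} {C : Setoid (Fin n)} :
    pairSetoid n a h ≤ C ↔ C.r ⟨a, by omega⟩ ⟨a + 1, h⟩ := by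
  constructor
  · intro hle
    refine hle ?_
    change (if _ then _ else _) = (if _ then _ else _)
    simp
  · intro hC x y hxy
    change (if _ then _ else _) = (if _ then _ else _) at hxy
    split_ifs at hxy with h1 h2 h2
    · subst h1; subst h2; exact C.refl' _
    · subst h1; subst hxy; exact C.symm' hC
    · subst h2; subst hxy; exact hC
    · subst hxy; exact C.refl' _

theorem g_mul_g (a : ℕ) (h : a + 1 < n) :
    g 𝕜 n q a h * g 𝕜 n q a h = algebraMap 𝕜 _ q +
      (q - 1) • (link 𝕜 n q ⟨a, by omega⟩ ⟨a + 1, h⟩ * g 𝕜 n q a h) := by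
  have hl := semiconjBy_link (𝕜 := 𝕜) (q := q) a h ⟨a, by omega⟩ ⟨a + 1, h⟩
  simp only [BT.sw, Equiv.swap_apply_left, Equiv.swap_apply_right] at hl
  rw [link_comm ⟨a + 1, h⟩] at hl
  rw [← hl.eq]
  refine ext_mul_ebar fun C => ?_
  rw [add_mul, smul_mul_assoc, mul_assoc (g 𝕜 n q a h) (link 𝕜 n q _ _), link_mul_ebar,
    Algebra.algebraMap_eq_smul_one, smul_mul_assoc, one_mul]
  split_ifs with hC
  · have hr := π_eq_of_rel (Rel.sqy (𝕜 := 𝕜) (q := q) a h C hC)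
    rw [pow_two, add_mul, Algebra.algebraMap_eq_smul_one] at hr
    simpa using! hr
  · have hr := π_eq_of_rel (Rel.sqn (𝕜 := 𝕜) (q := q) a h C hC)
    rw [pow_two] at hr
    simpa using! hr

end BTP

namespace BTP

variable {𝕜 : Type} [Field 𝕜] {n : ℕ} {q : 𝕜}

theorem sw_left (a : ℕ) (h : a + 1 < n) : BT.sw n a h ⟨a, by omega⟩ = ⟨a + 1, h⟩ :=
  Equiv.swap_apply_left _ _

theorem sw_right (a : ℕ) (h : a + 1 < n) : BT.sw n a h ⟨a + 1, h⟩ = ⟨a, by omega⟩ :=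
  Equiv.swap_apply_right _ _

theorem sw_of_ne (a b : ℕ) (h : a + 1 < n) (hb : b < n) (h1 : b ≠ a) (h2 : b ≠ a + 1) :
    BT.sw n a h ⟨b, hb⟩ = ⟨b, hb⟩ :=
  Equiv.swap_apply_of_ne_of_ne (by simpa using h1) (by simpa using h2)

variable (𝕜 n q) in
/-- The image of the generator `e_a` in `E′_n(q)`. -/
def tieSum (a : ℕ) (h : a + 1 < n) : E 𝕜 n q := link 𝕜 n q ⟨a, by omega⟩ ⟨a + 1, h⟩

theorem g_mul_tieSum (a : ℕ) (h : a + 1 < n) :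
    g 𝕜 n q a h * tieSum 𝕜 n q a h = tieSum 𝕜 n q a h * g 𝕜 n q a h := by
  have hl := semiconjBy_link (𝕜 := 𝕜) (q := q) a h ⟨a, by omega⟩ ⟨a + 1, h⟩
  rw [sw_left, sw_right, link_comm ⟨a + 1, h⟩] at hl
  exact hl

theorem g_mul_tieSum_of_far {a b : ℕ} (ha : a + 1 < n) (hb : b + 1 < n)
    (hab : a + 1 < b ∨ b + 1 < a) :
    g 𝕜 n q a ha * tieSum 𝕜 n q b hb = tieSum 𝕜 n q b hb * g 𝕜 n q a ha := by
  have hl := semiconjBy_link (𝕜 := 𝕜) (q := q) a ha ⟨b, by omega⟩ ⟨b + 1, hb⟩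
  rw [sw_of_ne _ _ _ _ (by omega) (by omega), sw_of_ne _ _ _ _ (by omega) (by omega)] at hl
  exact hl

theorem tieSum_mul_g_mul_g {a b : ℕ} (ha : a + 1 < n) (hb : b + 1 < n)
    (hab : b = a + 1 ∨ a = b + 1) :
    tieSum 𝕜 n q a ha * g 𝕜 n q b hb * g 𝕜 n q a ha =
      g 𝕜 n q b hb * g 𝕜 n q a ha * tieSum 𝕜 n q b hb := by
  have hl := (semiconjBy_link (𝕜 := 𝕜) (q := q) b hb _ _).mul_left
    (semiconjBy_link (𝕜 := 𝕜) (q := q) a ha ⟨b, by omega⟩ ⟨b + 1, hb⟩)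
  have hs : link 𝕜 n q (BT.sw n b hb (BT.sw n a ha ⟨b, by omega⟩))
      (BT.sw n b hb (BT.sw n a ha ⟨b + 1, hb⟩)) = tieSum 𝕜 n q a ha := by
    rcases hab with rfl | rfl
    · rw [sw_right, sw_of_ne a _ _ _ (by omega) (by omega), sw_right,
        sw_of_ne (a + 1) a _ _ (by omega) (by omega)]
      rfl
    · rw [sw_left, sw_of_ne (b + 1) b _ _ (by omega) (by omega), sw_left,
        sw_of_ne b (b + 1 + 1) _ _ (by omega) (by omega)]
      rfl
  rw [hs] at hl
  exact (mul_assoc _ _ _).trans hl.eq.symm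

/-- Moving `e_a` past an adjacent `g_b` yields a tie that, multiplied with either `e_a` or `e_b`,
gives `e_a e_b`. -/
theorem exists_semiconjBy_tieSum {a b : ℕ} (ha : a + 1 < n) (hb : b + 1 < n)
    (hab : b = a + 1 ∨ a = b + 1) :
    ∃ t : E 𝕜 n q, SemiconjBy (g 𝕜 n q b hb) (tieSum 𝕜 n q a ha) t ∧
      tieSum 𝕜 n q a ha * t = tieSum 𝕜 n q a ha * tieSum 𝕜 n q b hb ∧
      t * tieSum 𝕜 n q b hb = tieSum 𝕜 n q a ha * tieSum 𝕜 n q b hb := by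
  refine ⟨_, semiconjBy_link (𝕜 := 𝕜) (q := q) b hb ⟨a, by omega⟩ ⟨a + 1, ha⟩, ?_, ?_⟩ <;>
  rcases hab with rfl | rfl
  · rw [sw_left, sw_of_ne (a + 1) a _ _ (by omega) (by omega)]
    exact link_mul_link_congr fun C => ⟨fun h => ⟨h.1, C.trans' (C.symm' h.1) h.2⟩,
      fun h => ⟨h.1, C.trans' h.1 h.2⟩⟩
  · rw [sw_right, sw_of_ne b (b + 1 + 1) _ _ (by omega) (by omega)]
    exact link_mul_link_congr fun C => ⟨fun h => ⟨h.1, C.trans' h.2 (C.symm' h.1)⟩,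
      fun h => ⟨h.1, C.trans' h.2 h.1⟩⟩
  · rw [sw_left, sw_of_ne (a + 1) a _ _ (by omega) (by omega)]
    exact link_mul_link_congr fun C => ⟨fun h => ⟨C.trans' h.1 (C.symm' h.2), h.2⟩,
      fun h => ⟨C.trans' h.1 h.2, h.2⟩⟩
  · rw [sw_right, sw_of_ne b (b + 1 + 1) _ _ (by omega) (by omega)]
    exact link_mul_link_congr fun C => ⟨fun h => ⟨C.trans' (C.symm' h.2) h.1, h.2⟩,
      fun h => ⟨C.trans' h.2 h.1, h.2⟩⟩

variable (𝕜 n q) in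
/-- The homomorphism `E_n(q) → E′_n(q)`. -/
def ofBT : BT.B 𝕜 n q →ₐ[𝕜] E 𝕜 n q :=
  RingQuot.liftAlgHom 𝕜 ⟨FreeAlgebra.lift 𝕜 fun
    | .g a h => g 𝕜 n q a h
    | .e a h => tieSum 𝕜 n q a h, by
    intro x y hxy
    cases hxy with
    | ge a h => simpa [BT.G, BT.Eg] using g_mul_tieSum a h
    | braid a h => simpa [BT.G] using! π_eq_of_rel (Rel.braid (𝕜 := 𝕜) (q := q) a h)
    | gfar a b ha hb hab =>
      simpa [BT.G] using! π_eq_of_rel (Rel.gfar (𝕜 := 𝕜) (q := q) a b ha hb hab)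
    | egg a b ha hb hab => simpa [BT.G, BT.Eg] using tieSum_mul_g_mul_g ha hb hab
    | eeg1 a b ha hb hab =>
      obtain ⟨t, ht, h1, h2⟩ := exists_semiconjBy_tieSum (𝕜 := 𝕜) (q := q) ha hb hab
      simp only [BT.G, BT.Eg, map_mul, FreeAlgebra.lift_ι_apply]
      rw [mul_assoc _ (g 𝕜 n q b hb), ht.eq, ← mul_assoc, h1]
    | eeg2 a b ha hb hab =>
      obtain ⟨t, ht, h1, h2⟩ := exists_semiconjBy_tieSum (𝕜 := 𝕜) (q := q) ha hb hab
      simp only [BT.G, BT.Eg, map_mul, FreeAlgebra.lift_ι_apply]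
      rw [mul_assoc _ (g 𝕜 n q b hb), ht.eq, ← mul_assoc, h1, mul_assoc t, g_mul_tieSum,
        ← mul_assoc, h2]
    | ee a b ha hb =>
      simp only [BT.Eg, map_mul, FreeAlgebra.lift_ι_apply]
      exact link_mul_link_congr fun C => and_comm
    | gefar a b ha hb hab => simpa [BT.G, BT.Eg] using g_mul_tieSum_of_far ha hb hab
    | esq a ha =>
      simp only [BT.Eg, map_mul, FreeAlgebra.lift_ι_apply]
      exact link_mul_self _ _
    | gsq a ha => simpa [BT.G, BT.Eg, pow_two] using! g_mul_g a ha⟩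

theorem ofBT_g (a : ℕ) (h : a + 1 < n) : ofBT 𝕜 n q (BT.g 𝕜 n q a h) = g 𝕜 n q a h := by
  rw [ofBT, BT.g, BT.π, RingQuot.liftAlgHom_mkAlgHom_apply, BT.G, FreeAlgebra.lift_ι_apply]

theorem ofBT_e (a : ℕ) (h : a + 1 < n) : ofBT 𝕜 n q (BT.e 𝕜 n q a h) = tieSum 𝕜 n q a h := by
  rw [ofBT, BT.e, BT.π, RingQuot.liftAlgHom_mkAlgHom_apply, BT.Eg, FreeAlgebra.lift_ι_apply]

theorem semiconjBy_gUnit_tie (hq0 : q ≠ 0) (a : ℕ) (h : a + 1 < n) (x y : Fin n) :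
    SemiconjBy (BT.gUnit 𝕜 n q hq0 a : BT.B 𝕜 n q)
      (IsBraidTie.tie (BT.gUnit 𝕜 n q hq0) (BT.eTot 𝕜 n q) x y)
      (IsBraidTie.tie (BT.gUnit 𝕜 n q hq0) (BT.eTot 𝕜 n q) (BT.sw n a h x) (BT.sw n a h y)) := by
  have hval (z : Fin n) : (BT.sw n a h z : ℕ) = Equiv.swap a (a + 1) (z : ℕ) := by
    simp only [BT.sw, Equiv.swap_apply_def, Fin.ext_iff]
    split_ifs <;> simp_all
  rw [hval, hval]
  exact (BT.isBraidTie hq0).semiconjBy_tie h x.2 y.2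

variable (𝕜 n q) in
/-- The homomorphism `E′_n(q) → E_n(q)`. -/
def toBT (hq0 : q ≠ 0) : E 𝕜 n q →ₐ[𝕜] BT.B 𝕜 n q :=
  RingQuot.liftAlgHom 𝕜 ⟨FreeAlgebra.lift 𝕜 fun
    | .g a h => BT.g 𝕜 n q a h
    | .eb A => (BT.isBraidTie hq0).blockIdem A, by
    have tie_eq (a : ℕ) (h : a + 1 < n) :
        IsBraidTie.tie (BT.gUnit 𝕜 n q hq0) (BT.eTot 𝕜 n q) a (a + 1) = BT.e 𝕜 n q a h :=
      (IsBraidTie.tie_add a 0).trans (BT.eTot_eq h)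
    intro x y hxy
    cases hxy with
    | unit => simpa [EB] using (BT.isBraidTie hq0).sum_blockIdem
    | orth A C =>
      have h := (BT.isBraidTie (𝕜 := 𝕜) (n := n) hq0).blockIdem_mul A C
      split_ifs at h ⊢ <;> simpa [EB] using h
    | gmove a h A =>
      have hs := (BT.isBraidTie hq0).semiconjBy_blockIdem (semiconjBy_gUnit_tie hq0 a h) A
      rw [BT.val_gUnit hq0 h] at hs
      simpa [G, EB] using hs.eq
    | sqn a h A hA =>
      have ht := (BT.isBraidTie hq0).tie_mul_blockIdem A ⟨a, by omega⟩ ⟨a + 1, h⟩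
      rw [if_neg hA, tie_eq a h] at ht
      simp only [G, EB, map_mul, map_pow, map_smul, FreeAlgebra.lift_ι_apply]
      rw [pow_two, BT.g_mul_g, ← BT.g_mul_e, add_mul, smul_mul_assoc, mul_assoc, ht,
        Algebra.algebraMap_eq_smul_one]
      simp
    | sqy a h A hA =>
      have ht := (BT.isBraidTie hq0).tie_mul_blockIdem A ⟨a, by omega⟩ ⟨a + 1, h⟩
      rw [if_pos hA, tie_eq a h] at ht
      simp only [G, EB, map_mul, map_add, map_pow, map_smul, FreeAlgebra.lift_ι_apply,
        AlgHom.commutes]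
      rw [pow_two, BT.g_mul_g, ← BT.g_mul_e, add_mul, smul_mul_assoc, mul_assoc, ht, add_mul,
        smul_mul_assoc]
    | braid a h => simpa [G] using! BT.π_eq_of_rel (BT.Rel.braid (𝕜 := 𝕜) (q := q) a h)
    | gfar a b ha hb hab =>
      simpa [G] using! BT.π_eq_of_rel (BT.Rel.gfar (𝕜 := 𝕜) (q := q) a b ha hb hab)⟩

theorem toBT_g (hq0 : q ≠ 0) (a : ℕ) (h : a + 1 < n) :
    toBT 𝕜 n q hq0 (g 𝕜 n q a h) = BT.g 𝕜 n q a h := by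
  rw [toBT, g, π, RingQuot.liftAlgHom_mkAlgHom_apply, G, FreeAlgebra.lift_ι_apply]

theorem toBT_ebar (hq0 : q ≠ 0) (A : Setoid (Fin n)) :
    toBT 𝕜 n q hq0 (ebar 𝕜 n q A) = (BT.isBraidTie hq0).blockIdem A := by
  rw [toBT, ebar, π, RingQuot.liftAlgHom_mkAlgHom_apply, EB, FreeAlgebra.lift_ι_apply]

theorem toBT_link (hq0 : q ≠ 0) (x y : Fin n) :
    toBT 𝕜 n q hq0 (link 𝕜 n q x y) =
      IsBraidTie.tie (BT.gUnit 𝕜 n q hq0) (BT.eTot 𝕜 n q) x y := by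
  rw [link, map_sum, Finset.sum_filter, ← mul_one (IsBraidTie.tie _ _ _ _),
    ← (BT.isBraidTie hq0).sum_blockIdem, Finset.mul_sum]
  simp only [toBT_ebar, (BT.isBraidTie hq0).tie_mul_blockIdem]

theorem ofBT_tieAt (hq0 : q ≠ 0) {i d : ℕ} (h : i + d + 1 < n) :
    ofBT 𝕜 n q (IsBraidTie.tieAt (BT.gUnit 𝕜 n q hq0) (BT.eTot 𝕜 n q) i d) =
      link 𝕜 n q ⟨i, by omega⟩ ⟨i + d + 1, h⟩ := by
  induction d with
  | zero => exact (congrArg _ (BT.eTot_eq h)).trans (ofBT_e i h)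
  | succ d ih =>
    have h1 := (IsBraidTie.semiconjBy_tieAt_succ (BT.gUnit 𝕜 n q hq0) (BT.eTot 𝕜 n q) i d).map
      (ofBT 𝕜 n q)
    have h2 := semiconjBy_link (𝕜 := 𝕜) (q := q) (i + d + 1) h ⟨i, by omega⟩ ⟨i + d + 1, by omega⟩
    rw [sw_left, sw_of_ne _ _ _ _ (by omega) (by omega)] at h2
    rw [ih (by omega)] at h1
    rw [← ofBT_g, ← BT.val_gUnit hq0 (show i + d + 1 + 1 < n from h)] at h2
    exact SemiconjBy.eq_of_unit (u := Units.map (ofBT 𝕜 n q : BT.B 𝕜 n q →* E 𝕜 n q)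
      (BT.gUnit 𝕜 n q hq0 (i + d + 1))) h1 h2

theorem ofBT_tie (hq0 : q ≠ 0) (x y : Fin n) :
    ofBT 𝕜 n q (IsBraidTie.tie (BT.gUnit 𝕜 n q hq0) (BT.eTot 𝕜 n q) x y) = link 𝕜 n q x y := by
  wlog hxy : (x : ℕ) < y generalizing x y
  · rcases Nat.lt_or_ge (y : ℕ) x with h | h
    · rw [IsBraidTie.tie_comm, link_comm, this y x h]
    · obtain rfl : x = y := by omega
      rw [IsBraidTie.tie_self, link_self, map_one]
  obtain ⟨x, hx⟩ := x
  obtain ⟨y, hy⟩ := y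
  obtain ⟨d, rfl⟩ : ∃ d, y = x + d + 1 := ⟨y - x - 1, by simp at hxy; omega⟩
  exact (congrArg _ (IsBraidTie.tie_add x d)).trans (ofBT_tieAt hq0 hy)

theorem ofBT_blockIdem (hq0 : q ≠ 0) (A : Setoid (Fin n)) :
    ofBT 𝕜 n q ((BT.isBraidTie hq0).blockIdem A) = ebar 𝕜 n q A := by
  refine ext_mul_ebar fun C => ?_
  rw [ebar_mul_ebar]
  have h := (BT.isBraidTie hq0).map_blockIdem_mul (ofBT 𝕜 n q : BT.B 𝕜 n q →+* E 𝕜 n q)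
    (c := ebar 𝕜 n q C) (C := C) (fun x y => by
      change ofBT 𝕜 n q _ * _ = _
      rw [ofBT_tie, link_mul_ebar]) A
  refine Eq.trans h ?_
  split_ifs with hA
  · rw [hA]
  · rfl

variable (𝕜 n q) in
/-- The isomorphism between the bt-algebra `E_n(q)` and `E′_n(q)`. -/
def equivBT (hq0 : q ≠ 0) : BT.B 𝕜 n q ≃ₐ[𝕜] E 𝕜 n q :=
  AlgEquiv.ofAlgHom (ofBT 𝕜 n q) (toBT 𝕜 n q hq0)
    (by
      refine RingQuot.ringQuot_ext' 𝕜 _ _ (FreeAlgebra.hom_ext (funext fun x => ?_))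
      cases x with
      | g a h => exact (congrArg _ (toBT_g hq0 a h)).trans (ofBT_g a h)
      | eb A => exact (congrArg _ (toBT_ebar hq0 A)).trans (ofBT_blockIdem hq0 A))
    (by
      refine RingQuot.ringQuot_ext' 𝕜 _ _ (FreeAlgebra.hom_ext (funext fun x => ?_))
      cases x with
      | g a h => exact (congrArg _ (ofBT_g a h)).trans (toBT_g hq0 a h)
      | e a h =>
        exact (congrArg _ (ofBT_e a h)).trans ((toBT_link hq0 _ _).trans
          ((IsBraidTie.tie_add a 0).trans (BT.eTot_eq h))))

end BTP

/-- the bt-algebra `E_n(q)` and `E′_n(q)` are isomorphic as `𝕜`-algebras: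
there is an isomorphism `G : E_n(q) → E′_n(q)` with `G(g_a) = g_a` and
`G(e_a) = Σ_{B ⊇ A_a} ē(B)`, where `A_a` is the set partition whose only non-singleton
block is `{a, a+1}` and `A ⊆ B` means every block of `B` is a union of blocks of `A`. -/
theorem statement13 (𝕜 : Type) [Field 𝕜] (n : ℕ) (q : 𝕜) (hq0 : q ≠ 0) (hq1 : q ≠ 1) :
    ∃ Giso : BT.B 𝕜 n q ≃ₐ[𝕜] BTP.E 𝕜 n q,
      (∀ (a : ℕ) (h : a + 1 < n), Giso (BT.g 𝕜 n q a h) = BTP.g 𝕜 n q a h)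
      ∧ (∀ (a : ℕ) (h : a + 1 < n),
          Giso (BT.e 𝕜 n q a h)
            = ∑ C ∈ Finset.univ.filter
                (fun C : Setoid (Fin n) => BTP.pairSetoid n a h ≤ C),
                BTP.ebar 𝕜 n q C) := by
  refine ⟨BTP.equivBT 𝕜 n q hq0, BTP.ofBT_g, fun a h => (BTP.ofBT_e a h).trans ?_⟩
  simp only [BTP.pairSetoid_le_iff]
  rfl

end
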